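/- arXiv:1308.4247 — 2 statements merged into one kernel-verified Lean document; each statement's English description precedes it below -/
import Mathlib

section
/- Fix 0 < ε ≤ 1/3. There exist constants C > 0 and λ₀ > 0, depending only on ε, such that for every λ ≥ λ₀ and all dyadic integers 1 ≤ K ≤ L (K = 2^k, L = 2^ℓ): (a) for every z ∈ S_K, Σ_{w ∈ S_L, |z−w| < λ^ε} |z−w|₊^{−1/2} ≤ C·B_λ; and (b) for every w ∈ S_L, Σ_{z ∈ S_K, |z−w| < λ^ε} |z−w|₊^{−1/2} ≤ C·(K/L)·B_λ. -/
open MeasureTheory Real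

noncomputable section

/-- The Euclidean norm of a vector in `ℝ × ℝ`. -/
def e2 (x : ℝ × ℝ) : ℝ := Real.sqrt (x.1 ^ 2 + x.2 ^ 2)

/-- The integer vector `μ` viewed as a vector in `ℝ × ℝ`. -/
def iv (μ : ℤ × ℤ) : ℝ × ℝ := ((μ.1 : ℝ), (μ.2 : ℝ))

/-- The set of lattice points on the circle of radius `lam`. -/
def Elat (lam : ℝ) : Finset (ℤ × ℤ) := by
  classical
  exact (Finset.Icc (-⌈lam⌉, -⌈lam⌉) (⌈lam⌉, ⌈lam⌉)).filter
    (fun μ => (μ.1 : ℝ) ^ 2 + (μ.2 : ℝ) ^ 2 = lam ^ 2)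

/-- `B_lam`: the maximal number of lattice points on the circle of radius `lam`
lying in an arc of length `√lam`. -/
def Bmax (lam : ℝ) : ℕ := by
  classical
  exact sSup {n : ℕ | ∃ x : ℝ × ℝ, e2 x = lam ∧
    n = ((Elat lam).filter fun ξ => e2 (iv ξ - x) ≤ Real.sqrt lam).card}

/-- `Z_lam`: the set of medians `(μ+ν)/2` of pairs of lattice points on the circle
of radius `lam`. -/
def Zmed (lam : ℝ) : Finset (ℝ × ℝ) := by
  classical
  exact ((Elat lam) ×ˢ (Elat lam)).image fun p => ((1:ℝ)/2) • (iv p.1 + iv p.2)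

/-- `Δ(z) = √(lam² - |z|²)`, half the distance between the two points of the circle of
radius `lam` with midpoint `z`. -/
def Del (lam : ℝ) (z : ℝ × ℝ) : ℝ := Real.sqrt (lam ^ 2 - (e2 z) ^ 2)

/-- Rotation of a plane vector by `π/2`. -/
def perp (z : ℝ × ℝ) : ℝ × ℝ := (-z.2, z.1)

/-- `μ₊(z) = z + Δ(z)·z^⊥/|z^⊥|`, one of the two points on the circle of radius `lam`
whose midpoint is `z`. -/
def mup (lam : ℝ) (z : ℝ × ℝ) : ℝ × ℝ := z + (Del lam z / e2 z) • perp z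

/-- The dyadic class `S_K = {z ∈ Z_lam : |z| ≥ lam/2, K√lam ≤ Δ(z) < 2K√lam}`. -/
def SK (lam K : ℝ) : Finset (ℝ × ℝ) := by
  classical
  exact (Zmed lam).filter fun z => lam / 2 ≤ e2 z ∧
    K * Real.sqrt lam ≤ Del lam z ∧ Del lam z < 2 * K * Real.sqrt lam

/-- The Schur-test kernel sum `∑_{w ∈ s, |z-w| < lam^ε} |z-w|₊^{-1/2}`. -/
def kerSum (lam ε : ℝ) (s : Finset (ℝ × ℝ)) (z : ℝ × ℝ) : ℝ := by
  classical
  exact ∑ w ∈ s.filter (fun w => e2 (z - w) < lam ^ ε),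
    1 / Real.sqrt (max 1 (e2 (z - w)))

/-- The plane vector `x` as a complex number. -/
def toC (x : ℝ × ℝ) : ℂ := ⟨x.1, x.2⟩

theorem e2_eq_norm (x : ℝ × ℝ) : e2 x = ‖toC x‖ := by
  rw [e2, Complex.norm_eq_sqrt_sq_add_sq]
  rfl

theorem e2_nonneg (x : ℝ × ℝ) : 0 ≤ e2 x := Real.sqrt_nonneg _

theorem e2_sq (x : ℝ × ℝ) : e2 x ^ 2 = x.1 ^ 2 + x.2 ^ 2 := Real.sq_sqrt (by positivity)

theorem e2_add_le (x y : ℝ × ℝ) : e2 (x + y) ≤ e2 x + e2 y := by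
  have h : toC (x + y) = toC x + toC y := by
    apply Complex.ext <;> simp [toC]
  simp only [e2_eq_norm, h]
  exact norm_add_le _ _

theorem e2_smul (t : ℝ) (x : ℝ × ℝ) : e2 (t • x) = |t| * e2 x := by
  have h : toC (t • x) = t • toC x := by
    apply Complex.ext <;> simp [toC]
  simp only [e2_eq_norm, h, norm_smul, Real.norm_eq_abs]

theorem e2_perp (x : ℝ × ℝ) : e2 (perp x) = e2 x := by
  simp only [e2, perp]
  congr 1
  ring

theorem e2_sub_comm (x y : ℝ × ℝ) : e2 (x - y) = e2 (y - x) := by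
  simp only [e2, Prod.fst_sub, Prod.snd_sub]
  congr 1
  ring

theorem e2_sub_le (x y z : ℝ × ℝ) : e2 (x - z) ≤ e2 (x - y) + e2 (y - z) := by
  have h := e2_add_le (x - y) (y - z)
  rwa [sub_add_sub_cancel] at h

theorem abs_e2_sub_e2_le (x y : ℝ × ℝ) : |e2 x - e2 y| ≤ e2 (x - y) := by
  have h1 := e2_add_le (x - y) y
  have h2 := e2_add_le (y - x) x
  rw [sub_add_cancel] at h1 h2
  rw [e2_sub_comm y x] at h2
  rw [abs_le]
  constructor <;> linarith

theorem abs_fst_le_e2 (x : ℝ × ℝ) : |x.1| ≤ e2 x :=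
  Real.abs_le_sqrt (by nlinarith [sq_nonneg x.2])

theorem abs_snd_le_e2 (x : ℝ × ℝ) : |x.2| ≤ e2 x :=
  Real.abs_le_sqrt (by nlinarith [sq_nonneg x.1])

theorem mem_Elat_iff {lam : ℝ} (h0 : 0 ≤ lam) {μ : ℤ × ℤ} :
    μ ∈ Elat lam ↔ (μ.1 : ℝ) ^ 2 + (μ.2 : ℝ) ^ 2 = lam ^ 2 := by
  simp only [Elat, Finset.mem_filter, and_iff_right_iff_imp]
  intro h
  have key : ∀ a : ℤ, (a : ℝ) ^ 2 ≤ lam ^ 2 → -⌈lam⌉ ≤ a ∧ a ≤ ⌈lam⌉ := by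
    intro a ha
    have h1 := abs_le.1 (abs_le_of_sq_le_sq ha h0)
    have h2 := Int.le_ceil lam
    have h3 : (a : ℝ) ≤ (⌈lam⌉ : ℤ) := by linarith [h1.2]
    have h4 : ((-⌈lam⌉ : ℤ) : ℝ) ≤ a := by
      push_cast
      linarith [h1.1]
    exact ⟨by exact_mod_cast h4, by exact_mod_cast h3⟩
  have h1 := key μ.1 (by nlinarith [sq_nonneg (μ.2 : ℝ)])
  have h2 := key μ.2 (by nlinarith [sq_nonneg (μ.1 : ℝ)])
  rw [Finset.mem_Icc]
  exact ⟨⟨h1.1, h2.1⟩, ⟨h1.2, h2.2⟩⟩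

theorem e2_iv {lam : ℝ} (h0 : 0 ≤ lam) {μ : ℤ × ℤ} (h : μ ∈ Elat lam) : e2 (iv μ) = lam := by
  rw [mem_Elat_iff h0] at h
  simp only [e2, iv]
  rw [h, Real.sqrt_sq h0]

open Classical in
theorem card_ball_le_Bmax {lam : ℝ} (x : ℝ × ℝ) (hx : e2 x = lam) :
    ((Elat lam).filter fun ξ => e2 (iv ξ - x) ≤ Real.sqrt lam).card ≤ Bmax lam := by
  unfold Bmax
  apply le_csSup
  · refine ⟨(Elat lam).card, ?_⟩
    rintro n ⟨y, -, rfl⟩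
    exact Finset.card_filter_le _ _
  · exact ⟨x, hx, by congr⟩

open Classical in
/-- A finite set of lattice points of diameter at most `R * s`, of which every ball of radius `s`
centred in the set contains at most `M`, has at most `(4 * R + 1) ^ 2 * M` elements. -/
theorem card_le_of_local_card_le (A : Finset (ℤ × ℤ)) {s : ℝ} (hs : 0 < s) (R M : ℕ)
    (hdiam : ∀ a ∈ A, ∀ b ∈ A, e2 (iv a - iv b) ≤ R * s)
    (hloc : ∀ a ∈ A, (A.filter fun b => e2 (iv b - iv a) ≤ s).card ≤ M) :
    A.card ≤ (4 * R + 1) ^ 2 * M := by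
  rcases A.eq_empty_or_nonempty with rfl | ⟨o, ho⟩
  · simp
  let f : ℤ × ℤ → ℤ × ℤ := fun a =>
    (⌊2 * ((a.1 : ℝ) - o.1) / s⌋, ⌊2 * ((a.2 : ℝ) - o.2) / s⌋)
  have key : ∀ t : ℝ, |t| ≤ R * s → ⌊2 * t / s⌋ ∈ Finset.Icc (-(2 * R : ℤ)) (2 * R) := by
    intro t ht
    rw [abs_le] at ht
    rw [Finset.mem_Icc]
    constructor
    · rw [Int.le_floor, le_div_iff₀ hs]
      push_cast
      linarith [ht.1]
    · have h1 : (⌊2 * t / s⌋ : ℝ) ≤ 2 * R := by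
        refine (Int.floor_le _).trans ?_
        rw [div_le_iff₀ hs]
        linarith [ht.2]
      exact_mod_cast h1
  have hmaps : Set.MapsTo f A
      (Finset.Icc (-(2 * R : ℤ)) (2 * R) ×ˢ Finset.Icc (-(2 * R : ℤ)) (2 * R) :
        Finset (ℤ × ℤ)) := by
    intro a ha
    have h := hdiam a ha o ho
    have h1 := (abs_fst_le_e2 _).trans h
    have h2 := (abs_snd_le_e2 _).trans h
    simp only [iv, Prod.fst_sub, Prod.snd_sub] at h1 h2
    rw [Finset.mem_coe, Finset.mem_product]
    exact ⟨key _ h1, key _ h2⟩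
  have hfib : ∀ c ∈ (Finset.Icc (-(2 * R : ℤ)) (2 * R) ×ˢ Finset.Icc (-(2 * R : ℤ)) (2 * R) :
        Finset (ℤ × ℤ)), (A.filter fun a => f a = c).card ≤ M := by
    intro c _
    rcases (A.filter fun a => f a = c).eq_empty_or_nonempty with h | ⟨a, ha⟩
    · rw [h]
      simp
    rw [Finset.mem_filter] at ha
    refine (Finset.card_le_card ?_).trans (hloc a ha.1)
    intro b hb
    rw [Finset.mem_filter] at hb ⊢
    refine ⟨hb.1, ?_⟩
    have hab : f b = f a := hb.2.trans ha.2.symm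
    have cell : ∀ t u : ℝ, ⌊2 * t / s⌋ = ⌊2 * u / s⌋ → |t - u| ≤ s / 2 := by
      intro t u h
      have h1 := Int.abs_sub_lt_one_of_floor_eq_floor h
      have h2 : 2 * t / s - 2 * u / s = (t - u) * (2 / s) := by ring
      rw [h2, abs_mul, abs_of_pos (show (0 : ℝ) < 2 / s by positivity), ← lt_div_iff₀
        (by positivity)] at h1
      have h3 : 1 / (2 / s) = s / 2 := by field_simp
      linarith
    have h1 := cell _ _ (congrArg Prod.fst hab)
    have h2 := cell _ _ (congrArg Prod.snd hab)
    rw [sub_sub_sub_cancel_right] at h1 h2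
    rw [e2]
    apply Real.sqrt_le_iff.2
    refine ⟨hs.le, ?_⟩
    have h3 := sq_le_sq' (abs_le.1 h1).1 (abs_le.1 h1).2
    have h4 := sq_le_sq' (abs_le.1 h2).1 (abs_le.1 h2).2
    simp only [iv, Prod.fst_sub, Prod.snd_sub]
    nlinarith
  have h := Finset.card_le_mul_card_image_of_maps_to hmaps M hfib
  rw [Finset.card_product, Int.card_Icc] at h
  have h2 : ((2 * R : ℤ) + 1 - -(2 * R : ℤ)).toNat = 4 * R + 1 := by omega
  rw [h2] at h
  rw [mul_comm, sq]
  exact h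

/-- For two chords `u`, `v` issuing from a point `a` of a circle centred at the origin. -/
theorem chord_identity {a₁ a₂ u₁ u₂ v₁ v₂ : ℝ}
    (hu : u₁ ^ 2 + u₂ ^ 2 + 2 * (a₁ * u₁ + a₂ * u₂) = 0)
    (hv : v₁ ^ 2 + v₂ ^ 2 + 2 * (a₁ * v₁ + a₂ * v₂) = 0) :
    (u₁ ^ 2 + u₂ ^ 2) * (v₁ ^ 2 + v₂ ^ 2) * ((v₁ - u₁) ^ 2 + (v₂ - u₂) ^ 2) =
      4 * (u₁ * v₂ - u₂ * v₁) ^ 2 * (a₁ ^ 2 + a₂ ^ 2) := by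
  have h1 : 2 * (u₁ * v₂ - u₂ * v₁) * a₁ =
      (v₁ ^ 2 + v₂ ^ 2) * u₂ - (u₁ ^ 2 + u₂ ^ 2) * v₂ := by
    linear_combination v₂ * hu - u₂ * hv
  have h2 : 2 * (u₁ * v₂ - u₂ * v₁) * a₂ =
      (u₁ ^ 2 + u₂ ^ 2) * v₁ - (v₁ ^ 2 + v₂ ^ 2) * u₁ := by
    linear_combination u₁ * hv - v₁ * hu
  have h3 : 4 * (u₁ * v₂ - u₂ * v₁) ^ 2 * (a₁ ^ 2 + a₂ ^ 2) =
      (2 * (u₁ * v₂ - u₂ * v₁) * a₁) ^ 2 + (2 * (u₁ * v₂ - u₂ * v₁) * a₂) ^ 2 := by ring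
  rw [h3, h1, h2]
  ring

theorem e2_iv_sub_sq (a b : ℤ × ℤ) :
    e2 (iv a - iv b) ^ 2 = ((a.1 : ℝ) - b.1) ^ 2 + ((a.2 : ℝ) - b.2) ^ 2 := by
  rw [e2_sq]
  rfl

theorem e2_iv_sub_pos {a b : ℤ × ℤ} (h : a ≠ b) : 0 < e2 (iv a - iv b) := by
  refine lt_of_le_of_ne (e2_nonneg _) fun h0 => h ?_
  have h1 := e2_iv_sub_sq a b
  rw [← h0] at h1
  have h2 : ((a.1 : ℝ) - b.1) = 0 := by
    nlinarith [sq_nonneg ((a.1 : ℝ) - b.1), sq_nonneg ((a.2 : ℝ) - b.2)]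
  have h3 : ((a.2 : ℝ) - b.2) = 0 := by
    nlinarith [sq_nonneg ((a.1 : ℝ) - b.1), sq_nonneg ((a.2 : ℝ) - b.2)]
  exact Prod.ext (by exact_mod_cast sub_eq_zero.1 h2) (by exact_mod_cast sub_eq_zero.1 h3)

/-- Three distinct lattice points on the circle of radius `lam` span a triangle the product of whose
side lengths is at least `2 * lam`. -/
theorem two_mul_le_prod_sides {lam : ℝ} (h0 : 0 < lam) {a b c : ℤ × ℤ} (ha : a ∈ Elat lam)
    (hb : b ∈ Elat lam) (hc : c ∈ Elat lam) (hab : b ≠ a) (hac : c ≠ a) (hbc : c ≠ b) :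
    2 * lam ≤ e2 (iv b - iv a) * e2 (iv c - iv a) * e2 (iv c - iv b) := by
  rw [mem_Elat_iff h0.le] at ha hb hc
  have hid := chord_identity (a₁ := a.1) (a₂ := a.2) (u₁ := (b.1 : ℝ) - a.1)
    (u₂ := (b.2 : ℝ) - a.2) (v₁ := (c.1 : ℝ) - a.1) (v₂ := (c.2 : ℝ) - a.2)
    (by linear_combination hb - ha) (by linear_combination hc - ha)
  rw [sub_sub_sub_cancel_right, sub_sub_sub_cancel_right, ← e2_iv_sub_sq, ← e2_iv_sub_sq,
    ← e2_iv_sub_sq, ha] at hid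
  have p1 := e2_iv_sub_pos hab
  have p2 := e2_iv_sub_pos hac
  have p3 := e2_iv_sub_pos hbc
  set D : ℤ := (b.1 - a.1) * (c.2 - a.2) - (b.2 - a.2) * (c.1 - a.1) with hD
  have hDR : ((b.1 : ℝ) - a.1) * ((c.2 : ℝ) - a.2) - ((b.2 : ℝ) - a.2) * ((c.1 : ℝ) - a.1)
      = (D : ℝ) := by
    rw [hD]
    push_cast
    ring
  rw [hDR] at hid
  have hD0 : D ≠ 0 := by
    intro h
    rw [h] at hid
    have : 0 < e2 (iv b - iv a) ^ 2 * e2 (iv c - iv a) ^ 2 * e2 (iv c - iv b) ^ 2 := by positivity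
    rw [hid] at this
    simp at this
  have hD1 : (1 : ℝ) ≤ (D : ℝ) ^ 2 := by
    have h : 0 < D ^ 2 := by positivity
    exact_mod_cast h
  apply le_of_sq_le_sq _ (by positivity)
  nlinarith [sq_nonneg lam]

open Classical in
/-- A disc of radius `s / 2` with `s ^ 3 = lam` meets the circle in at most two lattice points of `A`. -/
theorem card_short_arc_le_two {lam s : ℝ} (h0 : 0 < lam) (hs : 0 < s) (hs3 : s ^ 3 = lam)
    (A : Finset (ℤ × ℤ)) (hA : ∀ a ∈ A, a ∈ Elat lam) (a : ℤ × ℤ) :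
    (A.filter fun b => e2 (iv b - iv a) ≤ s / 2).card ≤ 2 := by
  by_contra! h
  obtain ⟨x, y, z, hx, hy, hz, hxy, hxz, hyz⟩ := Finset.two_lt_card_iff.1 h
  rw [Finset.mem_filter] at hx hy hz
  have h1 := two_mul_le_prod_sides h0 (hA x hx.1) (hA y hy.1) (hA z hz.1) hxy.symm hxz.symm
    hyz.symm
  have near : ∀ p q : ℤ × ℤ, e2 (iv p - iv a) ≤ s / 2 → e2 (iv q - iv a) ≤ s / 2 →
      e2 (iv p - iv q) ≤ s := by
    intro p q hp hq
    have := e2_sub_le (iv p) (iv a) (iv q)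
    rw [e2_sub_comm (iv a)] at this
    linarith
  have n1 := near y x hy.2 hx.2
  have n2 := near z x hz.2 hx.2
  have n3 := near z y hz.2 hy.2
  have h2 : e2 (iv y - iv x) * e2 (iv z - iv x) * e2 (iv z - iv y) ≤ s * s * s := by
    gcongr <;> exact e2_nonneg _
  have h3 : s * s * s = lam := by rw [← hs3]; ring
  linarith

/-- A nonzero median is the midpoint of the lattice points `mup lam w` and `2 w - mup lam w`. -/
theorem exists_endpoints {lam : ℝ} (h0 : 0 < lam) {w : ℝ × ℝ} (hw : w ∈ Zmed lam)
    (hpos : 0 < e2 w) :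
    ∃ p : (ℤ × ℤ) × (ℤ × ℤ), p.1 ∈ Elat lam ∧ p.2 ∈ Elat lam ∧ iv p.1 = mup lam w ∧
      iv p.1 + iv p.2 = (2 : ℝ) • w := by
  simp only [Zmed, Finset.mem_image, Finset.mem_product] at hw
  obtain ⟨⟨μ, ν⟩, ⟨hμ, hν⟩, rfl⟩ := hw
  simp only at hμ hν hpos ⊢
  wlog hor : 0 ≤ (μ.2 : ℝ) * ν.1 - μ.1 * ν.2 generalizing μ ν
  · have hc : iv ν + iv μ = iv μ + iv ν := add_comm _ _
    have := this ν μ hν hμ (by rwa [hc]) (by linarith)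
    rwa [hc] at this
  refine ⟨(μ, ν), hμ, hν, ?_, by rw [smul_smul]; norm_num⟩
  have hμ' := (mem_Elat_iff h0.le).1 hμ
  have hν' := (mem_Elat_iff h0.le).1 hν
  set w : ℝ × ℝ := ((1 : ℝ) / 2) • (iv μ + iv ν) with hw
  have w1 : w.1 = ((μ.1 : ℝ) + ν.1) / 2 := by simp [hw, iv]; ring
  have w2 : w.2 = ((μ.2 : ℝ) + ν.2) / 2 := by simp [hw, iv]; ring
  have hS : e2 w ^ 2 = (lam ^ 2 + (μ.1 * ν.1 + μ.2 * ν.2)) / 2 := by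
    rw [e2_sq, w1, w2]
    linear_combination (1 / 4) * hμ' + (1 / 4) * hν'
  have hX : ((μ.2 : ℝ) * ν.1 - μ.1 * ν.2) ^ 2 =
      (lam ^ 2) ^ 2 - ((μ.1 : ℝ) * ν.1 + μ.2 * ν.2) ^ 2 := by
    linear_combination ((ν.1 : ℝ) ^ 2 + (ν.2 : ℝ) ^ 2) * hμ' + lam ^ 2 * hν'
  have hDel : Del lam w = ((μ.2 : ℝ) * ν.1 - μ.1 * ν.2) / (2 * e2 w) := by
    have h : lam ^ 2 - e2 w ^ 2 = (((μ.2 : ℝ) * ν.1 - μ.1 * ν.2) / (2 * e2 w)) ^ 2 := by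
      rw [div_pow, mul_pow, eq_div_iff (by positivity), hX, hS]
      ring
    rw [Del, h, Real.sqrt_sq (by positivity)]
  have hq : Del lam w / e2 w = ((μ.2 : ℝ) * ν.1 - μ.1 * ν.2) / (2 * e2 w ^ 2) := by
    rw [hDel]
    field_simp
  have hne : 2 * e2 w ^ 2 ≠ 0 := by positivity
  rw [mup, hq]
  apply Prod.ext
  · simp only [iv, perp, Prod.fst_add, Prod.smul_fst, smul_eq_mul]
    rw [div_mul_eq_mul_div, ← sub_eq_iff_eq_add', eq_div_iff hne, hS, w1, w2]
    linear_combination ((ν.1 : ℝ) / 2) * hμ' - ((μ.1 : ℝ) / 2) * hν'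
  · simp only [iv, perp, Prod.snd_add, Prod.smul_snd, smul_eq_mul]
    rw [div_mul_eq_mul_div, ← sub_eq_iff_eq_add', eq_div_iff hne, hS, w1, w2]
    linear_combination ((ν.2 : ℝ) / 2) * hμ' - ((μ.2 : ℝ) / 2) * hν'

theorem Del_le {lam : ℝ} (h0 : 0 ≤ lam) (w : ℝ × ℝ) : Del lam w ≤ lam :=
  Real.sqrt_le_iff.2 ⟨h0, by nlinarith [sq_nonneg (e2 w)]⟩

theorem e2_mup_sub_le {lam : ℝ} (h0 : 0 < lam) {w w' : ℝ × ℝ} (hw : lam / 2 ≤ e2 w)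
    (hw' : lam / 2 ≤ e2 w') :
    e2 (mup lam w - mup lam w') ≤ 5 * e2 (w - w') + |Del lam w - Del lam w'| := by
  have ha : 0 < e2 w := by linarith
  have hb : 0 < e2 w' := by linarith
  have hdec : mup lam w - mup lam w' = (w - w') + (((Del lam w - Del lam w') / e2 w) • perp w +
      ((Del lam w' / e2 w) • perp (w - w') +
        (Del lam w' * (e2 w' - e2 w) / (e2 w * e2 w')) • perp w')) := by
    apply Prod.ext
    · simp only [mup, perp, Prod.fst_add, Prod.fst_sub, Prod.snd_sub, Prod.smul_fst, smul_eq_mul]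
      field_simp
      ring
    · simp only [mup, perp, Prod.snd_add, Prod.fst_sub, Prod.snd_sub, Prod.smul_snd, smul_eq_mul]
      field_simp
      ring
  have hΔ : 0 ≤ Del lam w' := Real.sqrt_nonneg _
  have hq : Del lam w' / e2 w ≤ 2 := by
    rw [div_le_iff₀ ha]
    linarith [Del_le h0.le w']
  have hq0 : 0 ≤ Del lam w' / e2 w := by positivity
  have t1 : e2 (((Del lam w - Del lam w') / e2 w) • perp w) = |Del lam w - Del lam w'| := by
    rw [e2_smul, e2_perp, abs_div, abs_of_pos ha]
    field_simp
  have t2 : e2 ((Del lam w' / e2 w) • perp (w - w')) ≤ 2 * e2 (w - w') := by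
    rw [e2_smul, e2_perp, abs_of_nonneg hq0]
    exact mul_le_mul_of_nonneg_right hq (e2_nonneg _)
  have t3 : e2 ((Del lam w' * (e2 w' - e2 w) / (e2 w * e2 w')) • perp w') ≤ 2 * e2 (w - w') := by
    have h : |Del lam w' * (e2 w' - e2 w) / (e2 w * e2 w')| * e2 w' =
        Del lam w' / e2 w * |e2 w - e2 w'| := by
      rw [abs_div, abs_mul, abs_mul, abs_of_pos ha, abs_of_pos hb, abs_of_nonneg hΔ,
        abs_sub_comm (e2 w')]
      field_simp
    rw [e2_smul, e2_perp, h]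
    exact mul_le_mul hq (abs_e2_sub_e2_le w w') (abs_nonneg _) zero_le_two
  rw [hdec]
  refine (e2_add_le _ _).trans ?_
  have u1 := e2_add_le (((Del lam w - Del lam w') / e2 w) • perp w)
    ((Del lam w' / e2 w) • perp (w - w') +
        (Del lam w' * (e2 w' - e2 w) / (e2 w * e2 w')) • perp w')
  have u2 := e2_add_le ((Del lam w' / e2 w) • perp (w - w'))
    ((Del lam w' * (e2 w' - e2 w) / (e2 w * e2 w')) • perp w')
  linarith

open Classical in
/-- Medians in a small disc whose values of `Del` are close are counted by `Bmax`. -/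
theorem card_medians_le {lam : ℝ} (h1 : 1 ≤ lam) (A : Finset (ℝ × ℝ))
    (hA : ∀ w ∈ A, w ∈ Zmed lam ∧ lam / 2 ≤ e2 w)
    (hd : ∀ w ∈ A, ∀ w' ∈ A, e2 (w - w') ≤ 2 * lam ^ (1 / 3 : ℝ))
    (hΔ : ∀ w ∈ A, ∀ w' ∈ A, |Del lam w - Del lam w'| ≤ √lam) :
    A.card ≤ (33 ^ 2 * 2) * (45 ^ 2 * Bmax lam) := by
  have h0 : 0 < lam := by linarith
  set s : ℝ := lam ^ (1 / 3 : ℝ) with hs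
  have hs0 : 0 < s := by positivity
  have hs3 : s ^ 3 = lam := by
    rw [hs, ← Real.rpow_natCast, ← Real.rpow_mul h0.le]
    norm_num
  have hss : s ≤ √lam := by
    rw [hs, Real.sqrt_eq_rpow]
    exact Real.rpow_le_rpow_of_exponent_le h1 (by norm_num)
  have hr0 : 0 < √lam := Real.sqrt_pos.2 h0
  have hex : ∀ w ∈ A, ∃ p : (ℤ × ℤ) × (ℤ × ℤ), p.1 ∈ Elat lam ∧ p.2 ∈ Elat lam ∧
      iv p.1 = mup lam w ∧ iv p.1 + iv p.2 = (2 : ℝ) • w := fun w hw =>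
    exists_endpoints h0 (hA w hw).1 (by linarith [(hA w hw).2])
  choose! p hp1 hp2 hpm hps using hex
  have himg : (A.image fun w => (p w).1).card ≤ (4 * 11 + 1) ^ 2 * Bmax lam := by
    refine card_le_of_local_card_le _ hr0 11 _ ?_ ?_
    · simp only [Finset.mem_image]
      rintro _ ⟨w, hw, rfl⟩ _ ⟨w', hw', rfl⟩
      rw [hpm w hw, hpm w' hw']
      have := e2_mup_sub_le h0 (hA w hw).2 (hA w' hw').2
      have := hd w hw w' hw'
      have := hΔ w hw w' hw'
      push_cast
      linarith
    · simp only [Finset.mem_image]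
      rintro _ ⟨w, hw, rfl⟩
      refine (Finset.card_le_card ?_).trans
        (card_ball_le_Bmax (iv (p w).1) (e2_iv h0.le (hp1 w hw)))
      apply Finset.filter_subset_filter
      intro a ha
      obtain ⟨w', hw', rfl⟩ := Finset.mem_image.1 ha
      exact hp1 w' hw'
  have hfib : ∀ a ∈ A.image fun w => (p w).1,
      (A.filter fun w => (p w).1 = a).card ≤ (4 * 8 + 1) ^ 2 * 2 := by
    intro a _
    have key : ∀ w ∈ A, ∀ w' ∈ A, (p w).1 = a → (p w').1 = a →
        iv (p w).2 - iv (p w').2 = (2 : ℝ) • (w - w') := by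
      intro w hw w' hw' h h'
      rw [smul_sub, ← hps w hw, ← hps w' hw', h, h', add_sub_add_left_eq_sub]
    rw [← Finset.card_image_of_injOn (f := fun w => (p w).2)]
    · refine card_le_of_local_card_le _ (half_pos hs0) 8 2 ?_ ?_
      · simp only [Finset.mem_image, Finset.mem_filter]
        rintro _ ⟨w, ⟨hw, h⟩, rfl⟩ _ ⟨w', ⟨hw', h'⟩, rfl⟩
        rw [key w hw w' hw' h h', e2_smul, abs_two]
        have := hd w hw w' hw'
        push_cast
        linarith
      · intro b _
        refine card_short_arc_le_two h0 hs0 hs3 _ ?_ b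
        intro c hc
        obtain ⟨w, hw, rfl⟩ := Finset.mem_image.1 hc
        exact hp2 w (Finset.mem_filter.1 hw).1
    · intro w hw w' hw' h
      rw [Finset.mem_coe, Finset.mem_filter] at hw hw'
      have h2 := key w hw.1 w' hw'.1 hw.2 hw'.2
      simp only at h
      rw [h, sub_self] at h2
      exact sub_eq_zero.1 ((smul_eq_zero.1 h2.symm).resolve_left two_ne_zero)
  exact (Finset.card_le_mul_card_image A _ hfib).trans (Nat.mul_le_mul_left _ himg)

theorem mem_SK_iff {lam K : ℝ} {w : ℝ × ℝ} : w ∈ SK lam K ↔ w ∈ Zmed lam ∧ lam / 2 ≤ e2 w ∧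
    K * √lam ≤ Del lam w ∧ Del lam w < 2 * K * √lam := by
  simp only [SK, Finset.mem_filter]

/-- A Schur sum over `SK lam J` is at most `Bmax lam` times a sum of weights over the possible
integer parts of `Del / √lam`. -/
theorem kerSum_le_sum_weights {lam ε : ℝ} (h1 : 1 ≤ lam) (hε : ε ≤ 1 / 3) (J : ℕ) (z : ℝ × ℝ)
    (f : ℕ → ℝ) (hf0 : ∀ j, 0 ≤ f j)
    (hf : ∀ w ∈ SK lam J, 1 / √(max 1 (e2 (z - w))) ≤ f ⌊Del lam w / √lam⌋₊) :
    kerSum lam ε (SK lam J) z ≤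
      ((33 ^ 2 * 2) * (45 ^ 2 * Bmax lam) : ℕ) * ∑ j ∈ Finset.Ico J (2 * J), f j := by
  classical
  have h0 : 0 < lam := by linarith
  have hr0 : 0 < √lam := Real.sqrt_pos.2 h0
  have hn : ∀ v, 0 ≤ Del lam v / √lam := fun v => div_nonneg (Real.sqrt_nonneg _) hr0.le
  set S := (SK lam J).filter (fun w => e2 (z - w) < lam ^ ε) with hS
  have hmaps : ∀ w ∈ S, ⌊Del lam w / √lam⌋₊ ∈ Finset.Ico J (2 * J) := by
    intro w hw
    obtain ⟨-, -, hl, hu⟩ := mem_SK_iff.1 (Finset.mem_filter.1 hw).1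
    rw [Finset.mem_Ico]
    constructor
    · rw [Nat.le_floor_iff (hn w), le_div_iff₀ hr0]
      exact hl
    · rw [Nat.floor_lt (hn w), div_lt_iff₀ hr0]
      push_cast
      exact hu
  have hker : kerSum lam ε (SK lam J) z = ∑ w ∈ S, 1 / √(max 1 (e2 (z - w))) := by
    rw [kerSum, hS]
  rw [hker, ← Finset.sum_fiberwise_of_maps_to hmaps, Finset.mul_sum]
  apply Finset.sum_le_sum
  intro j _
  have hcard : (S.filter fun w => ⌊Del lam w / √lam⌋₊ = j).card ≤
      (33 ^ 2 * 2) * (45 ^ 2 * Bmax lam) := by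
    apply card_medians_le h1
    · intro w hw
      have h := mem_SK_iff.1 (Finset.mem_filter.1 (Finset.mem_filter.1 hw).1).1
      exact ⟨h.1, h.2.1⟩
    · intro w hw w' hw'
      have h2 := (Finset.mem_filter.1 (Finset.mem_filter.1 hw).1).2
      have h3 := (Finset.mem_filter.1 (Finset.mem_filter.1 hw').1).2
      have h4 := e2_sub_le w z w'
      rw [e2_sub_comm w z] at h4
      have h5 := Real.rpow_le_rpow_of_exponent_le h1 hε
      linarith
    · intro w hw w' hw'
      have h2 := (Finset.mem_filter.1 hw).2.trans (Finset.mem_filter.1 hw').2.symm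
      have h3 : |Del lam w / √lam - Del lam w' / √lam| ≤ 1 := by
        have a1 := Nat.floor_le (hn w)
        have a2 := Nat.floor_le (hn w')
        have a3 := Nat.lt_floor_add_one (Del lam w / √lam)
        have a4 := Nat.lt_floor_add_one (Del lam w' / √lam)
        rw [h2] at a1 a3
        rw [abs_le]
        constructor <;> linarith
      rw [← sub_div, abs_div, abs_of_pos hr0, div_le_one hr0] at h3
      exact h3
  calc ∑ w ∈ S with ⌊Del lam w / √lam⌋₊ = j, 1 / √(max 1 (e2 (z - w)))
      ≤ ∑ w ∈ S with ⌊Del lam w / √lam⌋₊ = j, f j := by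
        apply Finset.sum_le_sum
        intro w hw
        rw [Finset.mem_filter] at hw
        rw [← hw.2]
        exact hf w (Finset.mem_filter.1 hw.1).1
    _ = (S.filter fun w => ⌊Del lam w / √lam⌋₊ = j).card * f j := by
        rw [Finset.sum_const, nsmul_eq_mul]
    _ ≤ _ := by
        apply mul_le_mul_of_nonneg_right _ (hf0 j)
        exact_mod_cast hcard

theorem e2_le_of_mem_SK {lam K : ℝ} (h0 : 0 < lam) (hK : 0 < K) {w : ℝ × ℝ}
    (hw : w ∈ SK lam K) : e2 w ≤ lam := by
  have h1 := (mem_SK_iff.1 hw).2.2.1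
  have h2 : 0 < Del lam w := lt_of_lt_of_le (mul_pos hK (Real.sqrt_pos.2 h0)) h1
  have h3 := Real.sqrt_pos.1 h2
  exact le_of_sq_le_sq (by linarith) h0.le

theorem abs_Del_sq_sub_le {lam : ℝ} (h0 : 0 < lam) {w z : ℝ × ℝ} (hw : e2 w ≤ lam)
    (hz : e2 z ≤ lam) : |Del lam w ^ 2 - Del lam z ^ 2| ≤ 2 * lam * e2 (z - w) := by
  have hw0 := e2_nonneg w
  have hz0 := e2_nonneg z
  have h : Del lam w ^ 2 - Del lam z ^ 2 = (e2 z + e2 w) * (e2 z - e2 w) := by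
    rw [Del, Del, Real.sq_sqrt (by nlinarith), Real.sq_sqrt (by nlinarith)]
    ring
  rw [h, abs_mul, abs_of_nonneg (add_nonneg hz0 hw0)]
  exact mul_le_mul (by linarith) (abs_e2_sub_e2_le z w) (abs_nonneg _) (by linarith)

theorem sum_one_div_sqrt_le (n : ℕ) : ∑ m ∈ Finset.range (n + 1), 1 / √(m : ℝ) ≤ 2 * √n := by
  induction n with
  | zero => simp
  | succ n ih =>
    rw [Finset.sum_range_succ]
    have hp : 0 < √((n + 1 : ℕ) : ℝ) := Real.sqrt_pos.2 (by positivity)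
    have h1 : √((n + 1 : ℕ) : ℝ) ^ 2 = n + 1 := by
      rw [Real.sq_sqrt (by positivity)]
      push_cast
      rfl
    have h2 : √(n : ℝ) ^ 2 = n := Real.sq_sqrt (by positivity)
    have h3 : 1 / √((n + 1 : ℕ) : ℝ) ≤ 2 * (√((n + 1 : ℕ) : ℝ) - √n) := by
      rw [div_le_iff₀ hp]
      nlinarith [sq_nonneg (√((n + 1 : ℕ) : ℝ) - √n)]
    linarith

/-- A sum of a function of the distance `|j - i|` over distinct naturals `j`. -/
theorem sum_dist_le (g : ℕ → ℝ) (hg : ∀ m, 0 ≤ g m) (s : Finset ℕ) (i n : ℕ) (hi : i < n)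
    (hs : ∀ j ∈ s, j < n) :
    ∑ j ∈ s, g ((j - i) + (i - j)) ≤ 2 * ∑ m ∈ Finset.range n, g m := by
  rw [← Finset.sum_filter_add_sum_filter_not s (fun j => i ≤ j), two_mul]
  apply add_le_add
  · rw [← Finset.sum_image (f := g) (g := fun j => (j - i) + (i - j))]
    · apply Finset.sum_le_sum_of_subset_of_nonneg
      · intro m hm
        obtain ⟨j, hj, rfl⟩ := Finset.mem_image.1 hm
        rw [Finset.mem_filter] at hj
        have := hs j hj.1
        rw [Finset.mem_range]
        omega
      · exact fun m _ _ => hg m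
    · intro a ha b hb hab
      simp only [Finset.mem_coe, Finset.mem_filter] at ha hb hab
      omega
  · rw [← Finset.sum_image (f := g) (g := fun j => (j - i) + (i - j))]
    · apply Finset.sum_le_sum_of_subset_of_nonneg
      · intro m hm
        obtain ⟨j, hj, rfl⟩ := Finset.mem_image.1 hm
        rw [Finset.mem_filter] at hj
        rw [Finset.mem_range]
        omega
      · exact fun m _ _ => hg m
    · intro a ha b hb hab
      simp only [Finset.mem_coe, Finset.mem_filter] at ha hb hab
      omega

/-- The Schur sum over `SK lam J` at a point with `Del` of at most comparable size. -/
theorem kerSum_le_of_Del_lt {lam ε : ℝ} (h1 : 1 ≤ lam) (hε : ε ≤ 1 / 3) (J : ℕ) (hJ : 0 < J)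
    {z : ℝ × ℝ} (hz : e2 z ≤ lam) (hzJ : Del lam z < 4 * J * √lam) :
    kerSum lam ε (SK lam J) z ≤ ((33 ^ 2 * 2) * (45 ^ 2 * Bmax lam) : ℕ) * 20 := by
  have h0 : 0 < lam := by linarith
  have hr0 : 0 < √lam := Real.sqrt_pos.2 h0
  have hr := Real.sq_sqrt h0.le
  have hJ0 : (0 : ℝ) < J := by exact_mod_cast hJ
  have hn : ∀ v, 0 ≤ Del lam v / √lam := fun v => div_nonneg (Real.sqrt_nonneg _) hr0.le
  let g : ℕ → ℝ := fun m => (if m ≤ 1 then 1 else 0) + 2 / √J * (1 / √m)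
  have hg : ∀ m, 0 ≤ g m := fun m => by
    simp only [g]
    positivity
  set i := ⌊Del lam z / √lam⌋₊ with hi
  have hi4 : i < 4 * J := by
    rw [hi, Nat.floor_lt (hn z), div_lt_iff₀ hr0]
    push_cast
    exact hzJ
  refine (kerSum_le_sum_weights h1 hε J z (fun j => g ((j - i) + (i - j))) (fun j => hg _)
    ?_).trans ?_
  · intro w hw
    set j := ⌊Del lam w / √lam⌋₊ with hj
    set m := (j - i) + (i - j) with hm
    have hmax : 1 ≤ √(max 1 (e2 (z - w))) := by
      rw [Real.one_le_sqrt]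
      exact le_max_left _ _
    rcases le_or_gt m 1 with hm1 | hm1
    · have hle : 1 / √(max 1 (e2 (z - w))) ≤ 1 := by
        rw [div_le_one (by linarith)]
        exact hmax
      have : 0 ≤ 2 / √(J : ℝ) * (1 / √(m : ℝ)) := by positivity
      simp only [g, if_pos hm1]
      linarith
    · have hsep : (m : ℝ) / 2 * √lam ≤ |Del lam w - Del lam z| := by
        have b : (m : ℝ) / 2 ≤ |Del lam w / √lam - Del lam z / √lam| := by
          have a1 := Nat.floor_le (hn w)
          have a2 := Nat.floor_le (hn z)
          have a3 := Nat.lt_floor_add_one (Del lam w / √lam)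
          have a4 := Nat.lt_floor_add_one (Del lam z / √lam)
          rw [← hj] at a1 a3
          rw [← hi] at a2 a4
          have hm2 : (2 : ℝ) ≤ m := by exact_mod_cast hm1
          rcases le_total i j with hij | hij
          · have : (j : ℝ) = i + m := by exact_mod_cast (by omega : j = i + m)
            exact le_trans (by linarith) (le_abs_self _)
          · have : (i : ℝ) = j + m := by exact_mod_cast (by omega : i = j + m)
            exact le_trans (by linarith) (neg_le_abs _)
        rwa [← sub_div, abs_div, abs_of_pos hr0, le_div_iff₀ hr0] at b
      have hwJ := (mem_SK_iff.1 hw).2.2.1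
      have hz0 : 0 ≤ Del lam z := Real.sqrt_nonneg _
      have hd := abs_Del_sq_sub_le h0 (e2_le_of_mem_SK h0 hJ0 hw) hz
      have hfac : |Del lam w ^ 2 - Del lam z ^ 2| =
          |Del lam w - Del lam z| * (Del lam w + Del lam z) := by
        have : 0 ≤ Del lam w := Real.sqrt_nonneg _
        rw [← abs_of_nonneg (add_nonneg this hz0), ← abs_mul]
        congr 1
        ring
      have hprod : (m : ℝ) / 2 * √lam * (J * √lam) ≤
          |Del lam w - Del lam z| * (Del lam w + Del lam z) :=
        mul_le_mul hsep (by linarith) (by positivity) (abs_nonneg _)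
      have hlow : (m : ℝ) * J / 4 ≤ e2 (z - w) := by
        have hsq : (m : ℝ) / 2 * √lam * (J * √lam) = m * J / 2 * lam := by
          linear_combination (m : ℝ) * J / 2 * hr
        have : (m : ℝ) * J / 4 * lam ≤ e2 (z - w) * lam := by linarith
        exact le_of_mul_le_mul_right this h0
      have hm0 : (0 : ℝ) < m := by exact_mod_cast (by omega : 0 < m)
      have hroot : √(J : ℝ) * √(m : ℝ) / 2 ≤ √(max 1 (e2 (z - w))) := by
        apply Real.le_sqrt_of_sq_le
        rw [div_pow, mul_pow, Real.sq_sqrt hJ0.le, Real.sq_sqrt hm0.le]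
        refine le_trans ?_ (le_max_right _ _)
        linarith
      have hpos : 0 < √(J : ℝ) * √(m : ℝ) / 2 := by positivity
      simp only [g, if_neg (not_le.2 hm1), zero_add]
      refine (one_div_le_one_div_of_le hpos hroot).trans (le_of_eq ?_)
      field_simp
  · apply mul_le_mul_of_nonneg_left _ (Nat.cast_nonneg _)
    refine (sum_dist_le g hg _ i (4 * J) hi4 ?_).trans ?_
    · intro j hj
      rw [Finset.mem_Ico] at hj
      omega
    have hJs : 0 < √(J : ℝ) := Real.sqrt_pos.2 hJ0
    have hI : ∑ m ∈ Finset.range (4 * J), (if m ≤ 1 then (1 : ℝ) else 0) ≤ 2 := by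
      rw [Finset.sum_ite, Finset.sum_const_zero, add_zero, Finset.sum_const, nsmul_one]
      have h : ((Finset.range (4 * J)).filter fun m => m ≤ 1) ⊆ Finset.range 2 := by
        intro m hm
        rw [Finset.mem_filter] at hm
        rw [Finset.mem_range]
        omega
      exact_mod_cast (Finset.card_le_card h).trans (Finset.card_range 2).le
    have hS : ∑ m ∈ Finset.range (4 * J), 1 / √(m : ℝ) ≤ 4 * √(J : ℝ) := by
      have h := sum_one_div_sqrt_le (4 * J)
      rw [Finset.sum_range_succ] at h
      have h4 : √((4 * J : ℕ) : ℝ) = 2 * √(J : ℝ) := by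
        rw [Real.sqrt_eq_iff_mul_self_eq (by positivity) (by positivity)]
        push_cast
        nlinarith [Real.sq_sqrt hJ0.le]
      have : 0 ≤ 1 / √((4 * J : ℕ) : ℝ) := by positivity
      linarith
    have hS' : 2 / √(J : ℝ) * ∑ m ∈ Finset.range (4 * J), 1 / √(m : ℝ) ≤ 8 := by
      refine (mul_le_mul_of_nonneg_left hS (by positivity)).trans (le_of_eq ?_)
      field_simp
      norm_num
    simp only [g]
    rw [Finset.sum_add_distrib, ← Finset.mul_sum]
    linarith

/-- Proposition 7.2: row and column bounds for the dyadic blocks `A_{K,L}`: for dyadic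
`K = 2^k ≤ L = 2^l`, `∑_{w ∈ S_L, |z-w|<lam^ε} |z-w|₊^{-1/2} ≪ B_lam` for `z ∈ S_K`, and
`∑_{z ∈ S_K, |z-w|<lam^ε} |z-w|₊^{-1/2} ≪ (K/L)·B_lam` for `w ∈ S_L`. -/
theorem dyadic_block_schur_bounds
    (ε : ℝ) (hε0 : 0 < ε) (hε : ε ≤ 1/3) :
    ∃ C > (0:ℝ), ∃ lam0 > (0:ℝ), ∀ lam : ℝ, lam0 ≤ lam →
      ∀ k l : ℕ, k ≤ l →
        (∀ z ∈ SK lam ((2:ℝ) ^ k),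
          kerSum lam ε (SK lam ((2:ℝ) ^ l)) z ≤ C * (Bmax lam : ℝ)) ∧
        (∀ w ∈ SK lam ((2:ℝ) ^ l),
          kerSum lam ε (SK lam ((2:ℝ) ^ k)) w
            ≤ C * ((2:ℝ) ^ k / (2:ℝ) ^ l) * (Bmax lam : ℝ)) := by
  refine ⟨40 * ((33 ^ 2 * 2) * 45 ^ 2), by norm_num, 1, one_pos, fun lam h1 k l hkl => ?_⟩
  have h0 : 0 < lam := by linarith
  have hr0 : 0 < √lam := Real.sqrt_pos.2 h0
  have hB : (0 : ℝ) ≤ Bmax lam := Nat.cast_nonneg _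
  have cast_two_pow : ∀ m : ℕ, (2 : ℝ) ^ m = ((2 ^ m : ℕ) : ℝ) := fun m => by push_cast; rfl
  have hKL : (2 : ℝ) ^ k ≤ 2 ^ l := pow_le_pow_right₀ one_le_two hkl
  have hK0 : (0 : ℝ) < 2 ^ k := by positivity
  have hL0 : (0 : ℝ) < 2 ^ l := by positivity
  constructor
  · intro z hz
    have hzK := mem_SK_iff.1 hz
    rw [cast_two_pow l]
    refine (kerSum_le_of_Del_lt h1 hε (2 ^ l) (by positivity)
      (e2_le_of_mem_SK h0 hK0 hz) ?_).trans ?_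
    · rw [← cast_two_pow]
      nlinarith [hzK.2.2.2]
    · push_cast
      nlinarith
  · intro w hw
    have hwL := mem_SK_iff.1 hw
    rw [cast_two_pow k]
    rcases lt_or_ge l (k + 2) with hlk | hlk
    · have hL2 : (2 : ℝ) ^ l ≤ 2 * 2 ^ k := by
        rw [← pow_succ']
        exact pow_le_pow_right₀ one_le_two (by omega)
      refine (kerSum_le_of_Del_lt h1 hε (2 ^ k) (by positivity)
        (e2_le_of_mem_SK h0 hL0 hw) ?_).trans ?_
      · rw [← cast_two_pow]
        nlinarith [hwL.2.2.2]
      · rw [← cast_two_pow]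
        push_cast
        have hq : (1 : ℝ) / 2 ≤ 2 ^ k / 2 ^ l := by
          rw [div_le_div_iff₀ two_pos hL0]
          linarith
        nlinarith [mul_le_mul_of_nonneg_right hq hB]
    · have hL4 : 4 * (2 : ℝ) ^ k ≤ 2 ^ l := by
        have h : (2 : ℝ) ^ (k + 2) ≤ 2 ^ l := pow_le_pow_right₀ one_le_two hlk
        rw [pow_add] at h
        linarith
      refine (kerSum_le_sum_weights h1 hε (2 ^ k) w (fun _ => 2 / 2 ^ l)
        (fun _ => by positivity) ?_).trans ?_
      · intro z hz
        rw [← cast_two_pow] at hz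
        have hzK := mem_SK_iff.1 hz
        have hd := abs_Del_sq_sub_le h0 (e2_le_of_mem_SK h0 hK0 hz) (e2_le_of_mem_SK h0 hL0 hw)
        have hd' := (neg_le_abs _).trans hd
        have hr := Real.sq_sqrt h0.le
        have hw2 : (2 ^ l) ^ 2 * lam ≤ Del lam w ^ 2 := by
          refine le_trans (le_of_eq ?_) (pow_le_pow_left₀ (by positivity) hwL.2.2.1 2)
          rw [mul_pow, hr]
        have hz2 : Del lam z ^ 2 ≤ (2 ^ l / 2) ^ 2 * lam := by
          have hle : Del lam z ≤ 2 ^ l / 2 * √lam :=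
            hzK.2.2.2.le.trans (mul_le_mul_of_nonneg_right (by linarith) hr0.le)
          refine (pow_le_pow_left₀ (Real.sqrt_nonneg _) hle 2).trans (le_of_eq ?_)
          rw [mul_pow, hr]
        have hlow : ((2 : ℝ) ^ l / 2) ^ 2 ≤ e2 (w - z) := by
          have : ((2 : ℝ) ^ l / 2) ^ 2 * lam ≤ e2 (w - z) * lam := by nlinarith
          exact le_of_mul_le_mul_right this h0
        have hroot : (2 : ℝ) ^ l / 2 ≤ √(max 1 (e2 (w - z))) :=
          Real.le_sqrt_of_sq_le (hlow.trans (le_max_right _ _))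
        calc 1 / √(max 1 (e2 (w - z))) ≤ 1 / (2 ^ l / 2) :=
              one_div_le_one_div_of_le (by positivity) hroot
          _ = 2 / 2 ^ l := by rw [one_div_div]
      · rw [Finset.sum_const, Nat.card_Ico, nsmul_eq_mul]
        have hsub : 2 * 2 ^ k - 2 ^ k = 2 ^ k := by omega
        rw [hsub, ← cast_two_pow]
        push_cast
        have hq : 0 ≤ (2 : ℝ) ^ k / 2 ^ l * Bmax lam := by positivity
        calc _ = 2 * (33 ^ 2 * 2 * 45 ^ 2) * ((2 : ℝ) ^ k / 2 ^ l * Bmax lam) := by ring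
          _ ≤ 40 * (33 ^ 2 * 2 * 45 ^ 2) * ((2 : ℝ) ^ k / 2 ^ l * Bmax lam) := by
            apply mul_le_mul_of_nonneg_right _ hq
            norm_num
          _ = _ := by ring
end
end

section
/- Let β ∈ ℝ be irrational, let v₀ ∈ ℝ², and let C = {v₀ + t(1, −β) : |t| ≤ 1} be a segment of an irrational geodesic. Let p, q ∈ ℤ with q ≥ 1 and |β − p/q| < 1/q². Then F(x) = cos(⟨(p,q), x − v₀⟩) is a nonzero real-valued eigenfunction of the Laplacian on 𝕋² = ℝ²/(2πℤ²) with eigenvalue p² + q², and F(x) > 0 for every x ∈ C; in particular F has no zeros on C. Consequently, since for irrational β such approximations p/q exist with q arbitrarily large, there are arbitrarily large eigenvalues λ² of the Laplacian on 𝕋² admitting an eigenfunction with N_{F,C} = 0. -/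
open Real

noncomputable section

/-- The Laplacian `ΔG = ∂²G/∂x² + ∂²G/∂y²` of a function `G : ℝ → ℝ → ℝ`. -/
def lap (G : ℝ → ℝ → ℝ) (x y : ℝ) : ℝ :=
  deriv (fun u => deriv (fun u' => G u' y) u) x +
    deriv (fun v => deriv (fun v' => G x v') v) y

/-- An irrational number has rational approximations `r` with `|β - r| < 1 / r.den ^ 2` and
`r.num ^ 2 + r.den ^ 2` arbitrarily large. -/
theorem Irrational.exists_rat_abs_sub_lt_and_le_num_sq_add_den_sq {β : ℝ} (hβ : Irrational β)
    (Λ : ℝ) :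
    ∃ r : ℚ, |β - r| < 1 / (r.den : ℝ) ^ 2 ∧ Λ ≤ (r.num : ℝ) ^ 2 + (r.den : ℝ) ^ 2 := by
  obtain ⟨N, hN⟩ := exists_nat_ge Λ
  have hfin : ((fun r : ℚ => (r.num, r.den)) ⁻¹'
      Set.Icc (-(N : ℤ)) N ×ˢ Set.Icc 0 N).Finite := by
    refine Set.Finite.preimage (fun r _ s _ h => ?_)
      ((Set.finite_Icc _ _).prod (Set.finite_Icc _ _))
    exact Rat.ext (congrArg Prod.fst h) (congrArg Prod.snd h)
  obtain ⟨r, hr, hrN⟩ :=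
    (Real.infinite_rat_abs_sub_lt_one_div_den_sq_of_irrational hβ).exists_notMem_finite hfin
  refine ⟨r, hr, hN.trans ?_⟩
  by_contra! hlt
  have hZ : r.num ^ 2 + (r.den : ℤ) ^ 2 < N := by exact_mod_cast hlt
  refine hrN ⟨⟨?_, ?_⟩, Nat.zero_le _, ?_⟩ <;> dsimp only
  · nlinarith
  · nlinarith
  · zify
    nlinarith

/-- The phase of the wave with frequency `(p, q)` varies by less than a quarter period along the
segment `t ↦ t (1, -β)` when `p / q` is a Dirichlet approximation of `β`. -/
theorem cos_pos_of_abs_sub_div_lt {β : ℝ} {p q : ℤ} (hq : 1 ≤ q)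
    (h : |β - (p : ℝ) / (q : ℝ)| < 1 / (q : ℝ) ^ 2) (a b : ℝ) {t : ℝ} (ht : |t| ≤ 1) :
    0 < Real.cos ((p : ℝ) * ((a + t) - a) + (q : ℝ) * ((b + t * (-β)) - b)) := by
  have hq1 : (1 : ℝ) ≤ q := by exact_mod_cast hq
  have hq0 : (0 : ℝ) < q := by linarith
  have hphase : (p : ℝ) * ((a + t) - a) + (q : ℝ) * ((b + t * (-β)) - b)
      = -(t * (q * (β - p / q))) := by
    field_simp
    ring
  have hle : |(q : ℝ) * (β - p / q)| ≤ 1 := by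
    rw [abs_mul, abs_of_pos hq0]
    calc (q : ℝ) * |β - p / q| ≤ q * (1 / (q : ℝ) ^ 2) := by gcongr
      _ = 1 / q := by field_simp
      _ ≤ 1 := (div_le_one hq0).2 hq1
  rw [hphase, Real.cos_neg]
  refine Real.cos_pos_of_le_one ?_
  rw [abs_mul]
  exact mul_le_one₀ ht (abs_nonneg _) hle

/-- Second derivative of a cosine of an affine function. -/
theorem deriv_deriv_cos_mul_sub_add (k a c x : ℝ) :
    deriv (fun u => deriv (fun u' => Real.cos (k * (u' - a) + c)) u) x
      = -k ^ 2 * Real.cos (k * (x - a) + c) := by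
  have hlin (u : ℝ) : HasDerivAt (fun u' : ℝ => k * (u' - a) + c) k u := by
    simpa using (((hasDerivAt_id u).sub_const a).const_mul k).add_const c
  have hfirst : (fun u => deriv (fun u' => Real.cos (k * (u' - a) + c)) u)
      = fun u => -Real.sin (k * (u - a) + c) * k :=
    funext fun u => (hlin u).cos.deriv
  rw [hfirst, ((hlin x).sin.fun_neg.mul_const k).deriv]
  ring

/-- Eigenfunctions with no zeros on a segment `C = {v₀ + t(1,-β) : |t| ≤ 1}` of an irrational
geodesic: if `|β - p/q| < 1/q²` then `F(x) = cos(⟨(p,q), x - v₀⟩)` is a nonzero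
`2πℤ²`-periodic eigenfunction of the Laplacian with eigenvalue `p² + q²` which is strictly
positive on `C`; and since such approximations exist with `q` arbitrarily large, there are
arbitrarily large eigenvalues admitting an eigenfunction with no zeros on `C`. -/
theorem eigenfunctions_nonvanishing_on_irrational_geodesic
    (β : ℝ) (hβ : Irrational β) (v0 : ℝ × ℝ) (p q : ℤ) (hq : 1 ≤ q)
    (happ : |β - (p:ℝ) / (q:ℝ)| < 1 / (q:ℝ) ^ 2) :
    (∀ x y : ℝ, ∀ m m' : ℤ,
        Real.cos ((p:ℝ) * (x + 2 * π * m - v0.1) + (q:ℝ) * (y + 2 * π * m' - v0.2))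
          = Real.cos ((p:ℝ) * (x - v0.1) + (q:ℝ) * (y - v0.2))) ∧
    (∃ x y : ℝ, Real.cos ((p:ℝ) * (x - v0.1) + (q:ℝ) * (y - v0.2)) ≠ 0) ∧
    (∀ x y : ℝ, lap (fun u v => Real.cos ((p:ℝ) * (u - v0.1) + (q:ℝ) * (v - v0.2))) x y
        = -((p:ℝ) ^ 2 + (q:ℝ) ^ 2) *
            Real.cos ((p:ℝ) * (x - v0.1) + (q:ℝ) * (y - v0.2))) ∧
    (∀ t : ℝ, |t| ≤ 1 →
        0 < Real.cos ((p:ℝ) * ((v0.1 + t) - v0.1) + (q:ℝ) * ((v0.2 + t * (-β)) - v0.2))) ∧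
    (∀ Λ : ℝ, ∃ p' q' : ℤ, 1 ≤ q' ∧ |β - (p':ℝ) / (q':ℝ)| < 1 / (q':ℝ) ^ 2 ∧
        Λ ≤ (p':ℝ) ^ 2 + (q':ℝ) ^ 2 ∧
        ∀ t : ℝ, |t| ≤ 1 →
          Real.cos ((p':ℝ) * ((v0.1 + t) - v0.1) + (q':ℝ) * ((v0.2 + t * (-β)) - v0.2)) ≠ 0) := by
  refine ⟨fun x y m m' => ?_, ⟨v0.1, v0.2, by simp⟩, fun x y => ?_,
    fun t ht => cos_pos_of_abs_sub_div_lt hq happ _ _ ht, fun Λ => ?_⟩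
  · rw [← Real.cos_add_int_mul_two_pi (p * (x - v0.1) + q * (y - v0.2)) (p * m + q * m')]
    congr 1
    push_cast
    ring
  · have hy := deriv_deriv_cos_mul_sub_add q v0.2 (p * (x - v0.1)) y
    simp only [add_comm _ ((p : ℝ) * (x - v0.1))] at hy
    rw [lap, deriv_deriv_cos_mul_sub_add, hy]
    ring
  · obtain ⟨r, hr, hΛ⟩ := hβ.exists_rat_abs_sub_lt_and_le_num_sq_add_den_sq Λ
    have hden : (1 : ℤ) ≤ r.den := by exact_mod_cast r.pos
    have hr' : |β - (r.num : ℝ) / ((r.den : ℤ) : ℝ)| < 1 / ((r.den : ℤ) : ℝ) ^ 2 := by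
      rw [Int.cast_natCast, ← Rat.cast_def]
      exact hr
    exact ⟨r.num, r.den, hden, hr', by simpa using hΛ,
      fun t ht => (cos_pos_of_abs_sub_div_lt hden hr' _ _ ht).ne'⟩
end
end
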